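/- arXiv:2312.09774 — 2 statements merged into one kernel-verified Lean document; each statement's English description precedes it below -/
import Mathlib

section
/- Assume N ≥ 2. Let g ∈ GL_{N+1}(k) and let α = (α_0,…,α_N) ∈ ℤ^{N+1} \ {0} satisfy α_0 ≤ ⋯ ≤ α_N and Σ_{i=0}^N α_i = 0. Assume f_g(0,…,0) = 0, let δ_P := ord_0(f_g) ≥ 1, and assume that the lowest-degree homogeneous part in_{δ_P}(f_g) contains a monomial in which the variable x_{N−1} occurs (this holds in particular when the projective tangent cone of H at P = g([0:⋯:0:1]) is not the cone over a hypersurface contained in a projective hyperplane of P(T_P P^N_k) ≅ P^{N−1}_k). Then deg_α(F∘g) ≥ (d − 2δ_P + 1)·α_N − (δ_P − 1)·Σ_{i=1}^{N−2} α_i − (δ_P − 2)·α_{N−1}. -/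
open MvPolynomial

/-- The `α`-degree of a multivariate polynomial `G`: the maximum of `∑ i, m i * α i`
over the monomials `X^m` occurring in `G` with nonzero coefficient (0 if `G = 0`). -/
noncomputable def adeg {k : Type*} [CommSemiring k] {n : ℕ} (α : Fin n → ℤ)
    (G : MvPolynomial (Fin n) k) : ℤ :=
  if h : G.support.Nonempty then G.support.sup' h (fun m => ∑ i, (m i : ℤ) * α i) else 0

/-- `F ∘ g`: the polynomial obtained from `F` by the substitution `X i ↦ ∑ j, g i j • X j`. -/
noncomputable def substGL {k : Type*} [CommRing k] {n : ℕ}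
    (g : Matrix (Fin n) (Fin n) k) (F : MvPolynomial (Fin n) k) :
    MvPolynomial (Fin n) k :=
  aeval (fun i => ∑ j, C (g i j) * X j) F

/-- Dehomogenization with respect to the last variable:
`G(X_0, …, X_N) ↦ G(x_0, …, x_{N-1}, 1)`. -/
noncomputable def dehom {k : Type*} [CommRing k] {N : ℕ}
    (G : MvPolynomial (Fin (N+1)) k) : MvPolynomial (Fin N) k :=
  aeval (fun i : Fin (N+1) => if h : (i : ℕ) < N then X ⟨i, h⟩ else 1) G

/-- `ord_0 f`: the minimal total degree of a monomial occurring in `f`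
with nonzero coefficient (0 if `f = 0`). -/
noncomputable def ord0 {k : Type*} [CommSemiring k] {N : ℕ}
    (f : MvPolynomial (Fin N) k) : ℕ :=
  if h : f.support.Nonempty then f.support.inf' h (fun m => ∑ i, m i) else 0

/-- The ideal generated by `F` and its partial derivatives, defining the singular
locus `H_sing` of the hypersurface `H = {F = 0}`. -/
noncomputable def jacobianIdeal {k : Type*} [CommRing k] {N : ℕ}
    (F : MvPolynomial (Fin (N+1)) k) : Ideal (MvPolynomial (Fin (N+1)) k) :=
  Ideal.span ({F} ∪ Set.range (fun i => pderiv i F))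

theorem isHomogeneous_substGL {k : Type*} [CommRing k] {n d : ℕ}
    (g : Matrix (Fin n) (Fin n) k) {F : MvPolynomial (Fin n) k} (hF : F.IsHomogeneous d) :
    (substGL g F).IsHomogeneous d := by
  have h := hF.aeval (fun i => ∑ j, C (g i j) * X j) (n := 1) fun i =>
    IsHomogeneous.sum _ _ _ fun j _ => by
      simpa using (isHomogeneous_C (Fin n) (g i j)).mul (isHomogeneous_X k j)
  simpa [substGL] using h

theorem sum_eq_of_mem_support {k : Type*} [CommSemiring k] {n d : ℕ}
    {G : MvPolynomial (Fin n) k} (hG : G.IsHomogeneous d) {M : Fin n →₀ ℕ}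
    (hM : M ∈ G.support) : ∑ i, M i = d := by
  rw [← hG (mem_support_iff.mp hM), Finsupp.weight_apply, Finsupp.sum_fintype _ _ (by simp)]
  simp

theorem dehom_monomial {k : Type*} [CommRing k] {N : ℕ} (M : Fin (N+1) →₀ ℕ) (c : k) :
    dehom (monomial M c) =
      monomial (Finsupp.equivFunOnFinite.symm fun i : Fin N => M i.castSucc) c := by
  rw [dehom, aeval_monomial, Finsupp.prod_fintype _ _ (by simp), Fin.prod_univ_castSucc,
    monomial_eq, Finsupp.prod_fintype _ _ (by simp)]
  simp [algebraMap_eq]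

/-- Every monomial of the dehomogenization of `G` comes from a monomial of `G`. -/
theorem exists_mem_support_of_mem_support_dehom {k : Type*} [CommRing k] {N : ℕ}
    {G : MvPolynomial (Fin (N+1)) k} {m : Fin N →₀ ℕ} (hm : m ∈ (dehom G).support) :
    ∃ M ∈ G.support, ∀ i : Fin N, M i.castSucc = m i := by
  classical
  have hG : dehom G = ∑ M ∈ G.support, dehom (monomial M (coeff M G)) := by
    conv_lhs => rw [G.as_sum]
    simp only [dehom, map_sum]
  rw [hG] at hm
  obtain ⟨M, hM, hmM⟩ := Finset.mem_biUnion.mp (support_sum hm)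
  rw [dehom_monomial] at hmM
  have := Finset.mem_singleton.mp (support_monomial_subset hmM)
  exact ⟨M, hM, fun i => by simp [this]⟩

theorem le_adeg {k : Type*} [CommSemiring k] {n : ℕ} (α : Fin n → ℤ)
    {G : MvPolynomial (Fin n) k} {M : Fin n →₀ ℕ} (hM : M ∈ G.support) :
    ∑ i, (M i : ℤ) * α i ≤ adeg α G := by
  rw [adeg, dif_pos ⟨M, hM⟩]
  exact Finset.le_sup' (fun m : Fin n →₀ ℕ => ∑ i, (m i : ℤ) * α i) hM

/-- A weighted sum with monotone weights in which the last weight is used at least once. -/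
theorem last_add_mul_le_sum {n : ℕ} {a : Fin (n+1) → ℤ} (ha : Monotone a)
    {m : Fin (n+1) → ℕ} (hm : m (Fin.last n) ≠ 0) :
    a (Fin.last n) + ((∑ i, m i : ℕ) - 1 : ℤ) * a 0 ≤ ∑ i, (m i : ℤ) * a i := by
  have h : ∑ i : Fin n, (m i.castSucc : ℤ) * a 0 ≤ ∑ i : Fin n, (m i.castSucc : ℤ) * a i.castSucc :=
    Finset.sum_le_sum fun i _ => mul_le_mul_of_nonneg_left (ha (Fin.zero_le _)) (by positivity)
  have h0 : a 0 ≤ a (Fin.last n) := ha (Fin.zero_le _)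
  have h1 : (1 : ℤ) ≤ m (Fin.last n) := by exact_mod_cast Nat.one_le_iff_ne_zero.mpr hm
  rw [← Finset.sum_mul] at h
  rw [Fin.sum_univ_castSucc, Fin.sum_univ_castSucc]
  push_cast
  nlinarith

/-- Splitting off the first and the last two terms of a sum over `Fin (N + 1)`. -/
theorem sum_eq_first_add_middle_add_last_two {N : ℕ} (hN : 2 ≤ N) (a : Fin (N+1) → ℤ) :
    ∑ i, a i = a 0 + (∑ i ∈ Finset.univ.filter
      (fun i : Fin (N+1) => 1 ≤ (i : ℕ) ∧ (i : ℕ) ≤ N - 2), a i)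
      + a ⟨N-1, by omega⟩ + a (Fin.last N) := by
  obtain ⟨n, rfl⟩ := Nat.exists_eq_add_of_le' hN
  rw [Finset.sum_filter]
  simp only [Fin.sum_univ_castSucc (n := n + 2), Fin.sum_univ_castSucc (n := n + 1),
    Fin.sum_univ_succ (n := n)]
  have h (x : Fin n) : (x : ℕ) + 1 ≤ n := x.isLt
  simp [h]
  rfl

/-- The lower bound on the `α`-degree given by a monomial of degree `δ` of the
dehomogenization in which the last variable occurs. -/
theorem le_adeg_of_mem_support_dehom {k : Type*} [CommRing k] {N d δ : ℕ} (hN : 2 ≤ N)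
    {G : MvPolynomial (Fin (N+1)) k} (hG : G.IsHomogeneous d)
    {α : Fin (N+1) → ℤ} (hmono : Monotone α) (hsum : ∑ i, α i = 0)
    {m : Fin N →₀ ℕ} (hm : m ∈ (dehom G).support) (hmδ : ∑ i, m i = δ)
    (hmlast : m ⟨N-1, by omega⟩ ≠ 0) :
    ((d : ℤ) - 2 * δ + 1) * α (Fin.last N)
      - ((δ : ℤ) - 1) * (∑ i ∈ Finset.univ.filter
          (fun i : Fin (N+1) => 1 ≤ (i : ℕ) ∧ (i : ℕ) ≤ N - 2), α i)
      - ((δ : ℤ) - 2) * α ⟨N-1, by omega⟩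
      ≤ adeg α G := by
  obtain ⟨M, hM, hMm⟩ := exists_mem_support_of_mem_support_dehom hm
  have hdeg : ∑ i, M i = d := 
    sum_eq_of_mem_support hG hM
  rw [Fin.sum_univ_castSucc, Finset.sum_congr rfl fun i _ => hMm i, hmδ] at hdeg
  have hdegZ : (δ : ℤ) + M (Fin.last N) = d := by exact_mod_cast hdeg
  have hle := le_adeg α hM
  rw [Fin.sum_univ_castSucc] at hle
  simp only [hMm] at hle
  have hsplit := sum_eq_first_add_middle_add_last_two hN α
  rw [hsum] at hsplit
  have hbound : α ⟨N-1, by omega⟩ + ((δ : ℤ) - 1) * α 0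
      ≤ ∑ i : Fin N, (m i : ℤ) * α i.castSucc := by
    obtain ⟨n, rfl⟩ : ∃ n, N = n + 1 := ⟨N - 1, by omega⟩
    rw [← hmδ]
    have hα : Monotone fun i : Fin (n+1) => α i.castSucc :=
      hmono.comp Fin.strictMono_castSucc.monotone
    exact last_add_mul_le_sum (m := m) hα hmlast
  refine le_trans (le_of_eq ?_) ((add_le_add_left hbound _).trans hle)
  rw [← hdegZ]
  linear_combination ((δ : ℤ) - 1) * hsplit

/-- Assume `N ≥ 2`. If `P = g([0:⋯:0:1])` lies on `H = {F = 0}`, `δP` is the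
multiplicity of `H` at `P`, and the lowest-degree homogeneous part of `f_g` contains
a monomial in which `x_{N-1}` occurs (in particular, if the projective tangent cone of
`H` at `P` is not the cone over a hypersurface in a projective hyperplane), then
`deg_α (F∘g) ≥ (d - 2δP + 1)·α_N - (δP - 1)·∑_{i=1}^{N-2} α_i - (δP - 2)·α_{N-1}`. -/
theorem adeg_ge_of_tangentCone_not_cone {k : Type*} [Field k] [IsAlgClosed k]
    {N d : ℕ} (hN : 2 ≤ N) (hd : 2 ≤ d)
    (F : MvPolynomial (Fin (N+1)) k) (hF0 : F ≠ 0) (hFhom : F.IsHomogeneous d)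
    (g : Matrix.GeneralLinearGroup (Fin (N+1)) k)
    (α : Fin (N+1) → ℤ) (hα0 : α ≠ 0) (hmono : Monotone α) (hsum : ∑ i, α i = 0)
    (heval : MvPolynomial.eval (fun _ : Fin N => (0 : k)) (dehom (substGL (↑g) F)) = 0)
    (δP : ℕ) (hδP : δP = ord0 (dehom (substGL (↑g) F)))
    (hdep : ∃ m ∈ (dehom (substGL (↑g) F)).support,
      (∑ i, m i) = δP ∧ m ⟨N-1, by omega⟩ ≠ 0) :
    ((d : ℤ) - 2 * δP + 1) * α (Fin.last N)
      - ((δP : ℤ) - 1) * (∑ i ∈ Finset.univ.filter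
          (fun i : Fin (N+1) => 1 ≤ (i : ℕ) ∧ (i : ℕ) ≤ N - 2), α i)
      - ((δP : ℤ) - 2) * α ⟨N-1, by omega⟩
      ≤ adeg α (substGL (↑g) F) := by
  obtain ⟨m, hm, hmδ, hmlast⟩ := hdep
  exact le_adeg_of_mem_support_dehom hN (isHomogeneous_substGL _ hFhom) hmono hsum hm hmδ hmlast
end

section
/- Let g ∈ GL_{N+1}(k), let α = (α_0,…,α_N) ∈ ℤ^{N+1} \ {0} satisfy α_0 ≤ ⋯ ≤ α_N and Σ_{i=0}^N α_i = 0, let s ≥ −1 be an integer such that the Krull dimension of k[X_0,…,X_N]/J is at most s+1 (i.e. dim(H_sing) ≤ s), and let u, v ∈ ℕ with u + v = N − s − 1. Then deg_α(F∘g) ≥ α_u + (d−1)·α_v. -/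
open MvPolynomial

namespace MvPolynomial

/-- The maximal ideal of the origin has height at least the number of variables. -/
theorem le_height_ker_constantCoeff (k : Type*) [Field k] (n : ℕ) :
    (n : ℕ∞) ≤ (RingHom.ker (constantCoeff : MvPolynomial (Fin n) k →+* k)).height := by
  let φ (i : ℕ) : MvPolynomial (Fin n) k →ₐ[k] MvPolynomial (Fin n) k :=
    aeval fun j => if (j : ℕ) < i then 0 else X j
  have hφX (i : ℕ) (j : Fin n) : φ i (X j) = if (j : ℕ) < i then 0 else X j := aeval_X _ _
  have hprime (i : ℕ) : (RingHom.ker (φ i)).IsPrime := RingHom.ker_isPrime _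
  have hcomp (i : ℕ) : (φ (i + 1)).comp (φ i) = φ (i + 1) := by
    ext1 j
    simp only [AlgHom.comp_apply, hφX]
    split_ifs with h₁ h₂ h₂
    · simp
    · omega
    · simp [hφX, h₂]
    · simp [hφX, h₂]
  have hchain (i : ℕ) (hi : i ≤ n) : (i : ℕ∞) ≤ (RingHom.ker (φ i)).height := by
    induction i with
    | zero => simp
    | succ i ih =>
      have hlt : RingHom.ker (φ i) < RingHom.ker (φ (i + 1)) := by
        refine lt_of_le_of_ne (fun f hf => ?_) fun h => ?_
        · rw [RingHom.mem_ker] at hf ⊢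
          rw [← hcomp i, AlgHom.comp_apply, hf, map_zero]
        · have hX : (X ⟨i, hi⟩ : MvPolynomial (Fin n) k) ∈ RingHom.ker (φ (i + 1)) := by
            rw [RingHom.mem_ker, hφX, if_pos (Nat.lt_succ_self i)]
          rw [← h, RingHom.mem_ker, hφX, if_neg (lt_irrefl i)] at hX
          exact X_ne_zero _ hX
      push_cast
      exact (add_le_add_left (ih (by omega)) 1).trans
        (Ideal.height_add_one_le_of_lt_of_isPrime hlt)
  refine (hchain n le_rfl).trans (Ideal.height_mono fun f hf => ?_)
  have hconst : (aeval (fun _ => (0 : k)) : MvPolynomial (Fin n) k →ₐ[k] k).comp (φ n) =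
      aeval fun _ => (0 : k) := by
    ext1 j
    simp [hφX]
  rw [RingHom.mem_ker] at hf ⊢
  have := DFunLike.congr_fun hconst f
  rw [AlgHom.comp_apply, hf, map_zero, aeval_zero'] at this
  simpa using this.symm

theorem IsHomogeneous.constantCoeff_pderiv_eq_zero {σ R : Type*} [CommSemiring R] {d : ℕ}
    {G : MvPolynomial σ R} (hG : G.IsHomogeneous d) (hd : d ≠ 1) (i : σ) :
    constantCoeff (pderiv i G) = 0 := by
  rw [constantCoeff_eq, coeff_pderiv, hG.coeff_eq_zero (by simpa using hd.symm), zero_mul]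

end MvPolynomial

section substGL

variable {k : Type*} [CommRing k] {n : ℕ}

@[simp]
theorem substGL_X (g : Matrix (Fin n) (Fin n) k) (i : Fin n) :
    substGL g (X i) = ∑ j, C (g i j) * X j := aeval_X _ _

theorem substGL_add (g : Matrix (Fin n) (Fin n) k) (F G : MvPolynomial (Fin n) k) :
    substGL g (F + G) = substGL g F + substGL g G := map_add _ _ _

theorem substGL_mul (g : Matrix (Fin n) (Fin n) k) (F G : MvPolynomial (Fin n) k) :
    substGL g (F * G) = substGL g F * substGL g G := map_mul _ _ _

theorem MvPolynomial.IsHomogeneous.substGL {d : ℕ} {F : MvPolynomial (Fin n) k}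
    (hF : F.IsHomogeneous d) (g : Matrix (Fin n) (Fin n) k) :
    (substGL g F).IsHomogeneous d := by
  rw [← one_mul d]
  exact hF.aeval _ fun i => IsHomogeneous.sum _ _ _ fun j _ => isHomogeneous_C_mul_X _ _

theorem substGL_substGL (g h : Matrix (Fin n) (Fin n) k) (F : MvPolynomial (Fin n) k) :
    substGL h (substGL g F) = substGL (g * h) F := by
  have : (aeval fun i => ∑ j, C (h i j) * X j : MvPolynomial (Fin n) k →ₐ[k] _).comp
      (aeval fun i => ∑ j, C (g i j) * X j) = aeval fun i => ∑ j, C ((g * h) i j) * X j := by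
    ext1 i
    simp only [AlgHom.comp_apply, aeval_X, map_sum, map_mul, aeval_C, algebraMap_eq,
      Matrix.mul_apply, Finset.mul_sum, Finset.sum_mul]
    rw [Finset.sum_comm]
    simp only [mul_assoc]
  exact DFunLike.congr_fun this F

theorem substGL_one (F : MvPolynomial (Fin n) k) : substGL 1 F = F := by
  have : (aeval fun i => ∑ j, C ((1 : Matrix (Fin n) (Fin n) k) i j) * X j) =
      AlgHom.id k (MvPolynomial (Fin n) k) := by
    ext1 i
    simp [Matrix.one_apply, apply_ite (C : k → MvPolynomial (Fin n) k)]
  exact DFunLike.congr_fun this F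

theorem pderiv_substGL (g : Matrix (Fin n) (Fin n) k) (F : MvPolynomial (Fin n) k) (j : Fin n) :
    pderiv j (substGL g F) = ∑ i, C (g i j) * substGL g (pderiv i F) := by
  induction F using MvPolynomial.induction_on with
  | C a => simp [substGL]
  | add p q hp hq => simp only [substGL_add, map_add, hp, hq, mul_add, Finset.sum_add_distrib]
  | mul_X p l hp =>
    have hX : pderiv j (substGL g (X l)) = C (g l j) := by
      simp [pderiv_X, Pi.single_apply]
    have hi (i : Fin n) : substGL g (pderiv i (X l)) = if l = i then 1 else 0 := by
      rw [pderiv_X, Pi.single_apply]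
      split_ifs <;> simp [substGL]
    simp only [substGL_mul, pderiv_mul, substGL_add, hX, hp, hi, mul_add, Finset.sum_add_distrib,
      Finset.sum_mul, mul_ite, mul_one, mul_zero, Finset.sum_ite_eq, Finset.mem_univ, if_true,
      mul_assoc]
    rw [mul_comm (substGL g p)]

theorem substGL_pderiv (g : Matrix.GeneralLinearGroup (Fin n) k) (F : MvPolynomial (Fin n) k)
    (i : Fin n) :
    substGL (↑g) (pderiv i F) =
      ∑ j, C ((↑g⁻¹ : Matrix (Fin n) (Fin n) k) j i) * pderiv j (substGL (↑g) F) := by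
  simp only [pderiv_substGL, Finset.mul_sum, ← mul_assoc]
  rw [Finset.sum_comm]
  simp only [← Finset.sum_mul, ← C_mul, ← map_sum]
  have h (l : Fin n) : ∑ j, (↑g⁻¹ : Matrix (Fin n) (Fin n) k) j i * g.1 l j =
      (1 : Matrix (Fin n) (Fin n) k) l i := by
    rw [← g.mul_inv, Matrix.mul_apply]
    exact Finset.sum_congr rfl fun _ _ => mul_comm _ _
  simp only [h]
  simp [Matrix.one_apply, apply_ite (C : k → MvPolynomial (Fin n) k)]

end substGL

theorem ringKrullDim_quotient_jacobianIdeal_substGL_le {k : Type*} [CommRing k] {N : ℕ}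
    (g : Matrix.GeneralLinearGroup (Fin (N + 1)) k) (F : MvPolynomial (Fin (N + 1)) k) :
    ringKrullDim (MvPolynomial (Fin (N + 1)) k ⧸ jacobianIdeal (substGL (↑g) F)) ≤
      ringKrullDim (MvPolynomial (Fin (N + 1)) k ⧸ jacobianIdeal F) := by
  let φ : MvPolynomial (Fin (N + 1)) k →+* MvPolynomial (Fin (N + 1)) k :=
    (aeval fun i => ∑ j, C (g.1 i j) * X j : MvPolynomial (Fin (N + 1)) k →ₐ[k] _).toRingHom
  have hφ (P) : φ P = substGL (↑g) P := rfl
  have hsurj : Function.Surjective φ := fun P => by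
    refine ⟨substGL (↑g⁻¹) P, ?_⟩
    rw [hφ, substGL_substGL, ← Units.val_mul, inv_mul_cancel, Units.val_one, substGL_one]
  have hle : jacobianIdeal F ≤ (jacobianIdeal (substGL (↑g) F)).comap φ := by
    rw [jacobianIdeal, Ideal.span_le, Set.union_subset_iff, Set.singleton_subset_iff,
      Set.range_subset_iff]
    refine ⟨Ideal.subset_span (Or.inl rfl), fun i => ?_⟩
    rw [SetLike.mem_coe, Ideal.mem_comap, hφ, substGL_pderiv]
    exact Ideal.sum_mem _ fun j _ => Ideal.mul_mem_left _ _ (Ideal.subset_span (Or.inr ⟨j, rfl⟩))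
  exact ringKrullDim_le_of_surjective _ (Ideal.quotientMap_surjective (H := hle) hsurj)

/-- The ideal `(X_0, …, X_{v-1}, ∂_0 G, …, ∂_{u-1} G)`. -/
noncomputable def linearJacobianIdeal {k : Type*} [CommRing k] {n : ℕ}
    (G : MvPolynomial (Fin n) k) (u v : Fin n) : Ideal (MvPolynomial (Fin n) k) :=
  Ideal.span (X '' Set.Iio v ∪ (fun i => pderiv i G) '' Set.Iio u)

theorem le_ringKrullDim_quotient_linearJacobianIdeal {k : Type*} [Field k] {n d : ℕ} (hd : d ≠ 1)
    {G : MvPolynomial (Fin n) k} (hG : G.IsHomogeneous d) (u v : Fin n) :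
    (n : WithBot ℕ∞) ≤ ringKrullDim (MvPolynomial (Fin n) k ⧸ linearJacobianIdeal G u v) +
      ((v + u : ℕ) : WithBot ℕ∞) := by
  set S : Set (MvPolynomial (Fin n) k) := X '' Set.Iio v ∪ (fun i => pderiv i G) '' Set.Iio u
  have hIio (w : Fin n) : (Set.Iio w).encard = (w : ℕ) := by
    rw [← Finset.coe_Iio, Set.encard_coe_eq_coe_finsetCard, Fin.card_Iio]
  have hS : S.encard ≤ ((v + u : ℕ) : ℕ∞) := by
    push_cast
    rw [← hIio v, ← hIio u]
    exact (Set.encard_union_le _ _).trans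
      (add_le_add (Set.encard_image_le _ _) (Set.encard_image_le _ _))
  have hker : S ⊆ RingHom.ker (constantCoeff : MvPolynomial (Fin n) k →+* k) := by
    rintro _ (⟨i, -, rfl⟩ | ⟨i, -, rfl⟩)
    · simp
    · exact hG.constantCoeff_pderiv_eq_zero hd i
  have hprime : (RingHom.ker (constantCoeff : MvPolynomial (Fin n) k →+* k)).IsPrime :=
    RingHom.ker_isPrime _
  refine le_trans ?_ ((Ideal.height_le_ringKrullDim_quotient_add_encard S hker).trans
    (add_le_add_right (WithBot.coe_le_coe.mpr hS) _))
  exact WithBot.coe_le_coe.mpr (le_height_ker_constantCoeff k n)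

theorem mul_le_sum_mul_of_monotone {n : ℕ} {α : Fin n → ℤ} (hα : Monotone α) {v : Fin n}
    {m : Fin n →₀ ℕ} (hm : ∀ i < v, m i = 0) :
    (m.degree : ℤ) * α v ≤ ∑ i, (m i : ℤ) * α i := by
  rw [Finsupp.degree_eq_sum, Nat.cast_sum, Finset.sum_mul]
  refine Finset.sum_le_sum fun i _ => ?_
  rcases lt_or_ge i v with h | h
  · simp [hm i h]
  · exact mul_le_mul_of_nonneg_left (hα h) (Int.natCast_nonneg _)

theorem jacobianIdeal_le_linearJacobianIdeal {k : Type*} [CommRing k] {N d : ℕ}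
    {G : MvPolynomial (Fin (N + 1)) k} (hG : G.IsHomogeneous d) {α : Fin (N + 1) → ℤ}
    (hα : Monotone α) {u v : Fin (N + 1)} (huv : u ≤ v)
    (hlt : ∀ m ∈ G.support, ∑ i, (m i : ℤ) * α i < α u + ((d : ℤ) - 1) * α v) :
    jacobianIdeal G ≤ linearJacobianIdeal G u v := by
  have hX : Ideal.span (X '' Set.Iio v) ≤ linearJacobianIdeal G u v :=
    Ideal.span_mono Set.subset_union_left
  rw [jacobianIdeal, Ideal.span_le, Set.union_subset_iff, Set.singleton_subset_iff,
    Set.range_subset_iff]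
  have hdeg : ∀ m ∈ G.support, m.degree = d := fun m hm =>
    by_contra fun h => mem_support_iff.mp hm (hG.coeff_eq_zero h)
  refine ⟨hX (mem_ideal_span_X_image.mpr fun m hm => ?_), fun i => ?_⟩
  · by_contra! h
    have h₁ := mul_le_sum_mul_of_monotone hα h
    rw [hdeg m hm] at h₁
    linarith [hlt m hm, hα huv]
  · rcases lt_or_ge i u with hi | hi
    · exact Ideal.subset_span (Or.inr ⟨i, hi, rfl⟩)
    refine hX (mem_ideal_span_X_image.mpr fun m hm => ?_)
    by_contra! h
    have hm' : m + Finsupp.single i 1 ∈ G.support := by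
      rw [mem_support_iff, coeff_pderiv] at hm
      exact mem_support_iff.mpr (left_ne_zero_of_mul hm)
    have h₁ := mul_le_sum_mul_of_monotone hα h
    have h₂ := hlt _ hm'
    have h₃ : d = m.degree + 1 := by
      simpa using (hdeg _ hm').symm
    have h₄ : ∑ j, ((m + Finsupp.single i 1 : Fin (N + 1) →₀ ℕ) j : ℤ) * α j =
        ∑ j, (m j : ℤ) * α j + α i := by
      simp [add_mul, Finset.sum_add_distrib, Finsupp.single_apply]
    rw [h₄, h₃] at h₂
    push_cast at h₂
    linarith [hα hi]

theorem sum_le_adeg {k : Type*} [CommSemiring k] {n : ℕ} (α : Fin n → ℤ)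
    {G : MvPolynomial (Fin n) k} {m : Fin n →₀ ℕ} (hm : m ∈ G.support) :
    ∑ i, (m i : ℤ) * α i ≤ adeg α G := by
  rw [adeg, dif_pos ⟨m, hm⟩]
  exact Finset.le_sup' (fun m : Fin n →₀ ℕ => ∑ i, (m i : ℤ) * α i) hm

theorem le_ringKrullDim_quotient_jacobianIdeal_of_adeg_lt {k : Type*} [Field k] {N d : ℕ}
    (hd : 2 ≤ d) {G : MvPolynomial (Fin (N + 1)) k} (hG : G.IsHomogeneous d)
    {α : Fin (N + 1) → ℤ} (hα : Monotone α) (u v : Fin (N + 1))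
    (hlt : adeg α G < α u + ((d : ℤ) - 1) * α v) :
    ((N + 1 : ℕ) : WithBot ℕ∞) ≤ ringKrullDim (MvPolynomial (Fin (N + 1)) k ⧸ jacobianIdeal G) +
      ((u + v : ℕ) : WithBot ℕ∞) := by
  wlog huv : u ≤ v generalizing u v
  · rw [add_comm (u : ℕ)]
    refine this v u (hlt.trans_le ?_) (le_of_not_ge huv)
    have hd' : (2 : ℤ) ≤ d := by exact_mod_cast hd
    nlinarith [hα (le_of_not_ge huv)]
  have hle := jacobianIdeal_le_linearJacobianIdeal hG hα huv fun m hm =>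
    (sum_le_adeg α hm).trans_lt hlt
  rw [add_comm (u : ℕ)]
  refine (le_ringKrullDim_quotient_linearJacobianIdeal (by omega) hG u v).trans
    (add_le_add_left (ringKrullDim_le_of_surjective _ (Ideal.Quotient.factor_surjective hle)) _)

/-- If `dim H_sing ≤ s` and `u + v = N - s - 1`, then
`deg_α (F∘g) ≥ α_u + (d-1)·α_v`. -/
theorem adeg_ge_of_dim_singular_le {k : Type*} [Field k] [IsAlgClosed k]
    {N d : ℕ} (hN : 1 ≤ N) (hd : 2 ≤ d)
    (F : MvPolynomial (Fin (N+1)) k) (hF0 : F ≠ 0) (hFhom : F.IsHomogeneous d)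
    (g : Matrix.GeneralLinearGroup (Fin (N+1)) k)
    (α : Fin (N+1) → ℤ) (hα0 : α ≠ 0) (hmono : Monotone α) (hsum : ∑ i, α i = 0)
    (s : ℤ) (hs : -1 ≤ s)
    (hsing : ringKrullDim (MvPolynomial (Fin (N+1)) k ⧸ jacobianIdeal F)
      ≤ ((s+1).toNat : WithBot ℕ∞))
    (u v : ℕ) (huv : (u : ℤ) + (v : ℤ) = (N : ℤ) - s - 1) :
    α ⟨u, by omega⟩ + ((d : ℤ) - 1) * α ⟨v, by omega⟩ ≤ adeg α (substGL (↑g) F) := by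
  by_contra! hlt
  have h := (le_ringKrullDim_quotient_jacobianIdeal_of_adeg_lt hd (hFhom.substGL _) hmono _ _
    hlt).trans (add_le_add_left
      ((ringKrullDim_quotient_jacobianIdeal_substGL_le g F).trans hsing) _)
  norm_cast at h
  dsimp only at h
  omega
end
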